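/- Let K ⊂ ℝ^m be a convex body with C² boundary and nowhere vanishing Gaussian curvature, and let κ be the maximum of the principal curvatures over ∂K, attained at p ∈ ∂K with corresponding center of curvature c = p + (1/κ)n(p) (n the inward normal). Then the closed ball of radius 1/κ centered at c is contained in K (Blaschke's Rolling Ball Theorem), and the function x ↦ |x − c| on ∂K attains its global minimum at p. -/

import Mathlib

open RealInnerProductSpace

/-- `κ` is a normal curvature of `∂K` at `q` with respect to the unit normal `ν`:
the normal component of the acceleration of some unit-speed `C²` curve in `∂K`
through `q`. (Principal curvatures are normal curvatures, and all normal
curvatures lie between the least and greatest principal curvature.) -/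
def IsNormalCurvatureAt {m : ℕ} (K : Set (EuclideanSpace ℝ (Fin m)))
    (q ν : EuclideanSpace ℝ (Fin m)) (κ : ℝ) : Prop :=
  ∃ γ : ℝ → EuclideanSpace ℝ (Fin m), ContDiff ℝ 2 γ ∧ (∀ s, γ s ∈ frontier K) ∧
    γ 0 = q ∧ ‖deriv γ 0‖ = 1 ∧ ⟪deriv (deriv γ) 0, ν⟫ = κ

section RollingBall

open Set Filter Topology

lemma deriv_deriv_comp_curve {E : Type*} [NormedAddCommGroup E] [NormedSpace ℝ E]
    {f : E → ℝ} (hf : ContDiff ℝ 2 f) {β : ℝ → E} (hβ : ContDiff ℝ 2 β) (t : ℝ) :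
    deriv (deriv (fun s => f (β s))) t =
      fderiv ℝ (fderiv ℝ f) (β t) (deriv β t) (deriv β t) +
        fderiv ℝ f (β t) (deriv (deriv β) t) := by
  have hβ1 : Differentiable ℝ β := hβ.differentiable (by norm_num)
  have hf1 : Differentiable ℝ f := hf.differentiable (by norm_num)
  have hβ2 : Differentiable ℝ (deriv β) :=
    (contDiff_succ_iff_deriv (n := 1).1 hβ).2.2.differentiable (by norm_num)
  have hf2 : Differentiable ℝ (fderiv ℝ f) :=
    (contDiff_succ_iff_fderiv (n := 1).1 hf).2.2.differentiable (by norm_num)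
  have h1 : deriv (fun s => f (β s)) = fun s => fderiv ℝ f (β s) (deriv β s) := by
    funext s
    exact ((hf1 (β s)).hasFDerivAt.comp_hasDerivAt s (hβ1 s).hasDerivAt).deriv
  rw [h1]
  exact (((hf2 (β t)).hasFDerivAt.comp_hasDerivAt t (hβ1 t).hasDerivAt).clm_apply
    (hβ2 t).hasDerivAt).deriv

/-- A regular point at which a linear functional `⟪·, u⟫` is maximal on a sublevel set has gradient
a positive multiple of `u`. -/
lemma exists_fderiv_eq_mul_inner {E : Type*} [NormedAddCommGroup E] [InnerProductSpace ℝ E]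
    [CompleteSpace E] {f : E → ℝ} {x u : E} (hf : DifferentiableAt ℝ f x)
    (hne : fderiv ℝ f x ≠ 0) (hu : ‖u‖ = 1)
    (hmax : ∀ y, f y ≤ f x → ⟪y, u⟫ ≤ ⟪x, u⟫) :
    ∃ g : ℝ, 0 < g ∧ ∀ w, fderiv ℝ f x w = g * ⟪u, w⟫ := by
  set G := (InnerProductSpace.toDual ℝ E).symm (fderiv ℝ f x) with hG
  have hGw : ∀ w, fderiv ℝ f x w = ⟪G, w⟫ := fun w => by
    rw [hG, InnerProductSpace.toDual_symm_apply]
  have hG0 : G ≠ 0 := by simpa [hG] using hne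
  have hdesc : ∀ w, ⟪G, w⟫ < 0 → ⟪w, u⟫ ≤ 0 := by
    intro w hw
    have hd : HasDerivAt (fun t : ℝ => f (x + t • w)) ⟪G, w⟫ 0 := by
      rw [← hGw]
      have h2 : HasDerivAt (fun t : ℝ => x + t • w) w 0 := by
        simpa using ((hasDerivAt_id (0 : ℝ)).smul_const w).const_add x
      have h3 : HasFDerivAt f (fderiv ℝ f x) (x + (0 : ℝ) • w) := by simpa using hf.hasFDerivAt
      exact h3.comp_hasDerivAt 0 h2
    have hev : ∀ᶠ t in 𝓝[>] (0 : ℝ), f (x + t • w) ≤ f x := by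
      have := (hasDerivAt_iff_tendsto_slope.1 hd).eventually_lt_const hw
      have h4 := this.filter_mono (nhdsWithin_mono 0 (fun t (ht : 0 < t) => ht.ne'))
      filter_upwards [h4, self_mem_nhdsWithin] with t ht ht0
      rw [slope_def_field] at ht
      have ht0' : (0 : ℝ) < t := ht0
      have : (f (x + t • w) - f (x + (0:ℝ) • w)) < 0 := by
        by_contra! hc
        exact absurd ht (not_lt.2 (div_nonneg hc (by linarith)))
      simp at this
      exact this.le
    obtain ⟨t, ht, ht0⟩ := (hev.and self_mem_nhdsWithin).exists
    have h5 := hmax _ ht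
    rw [inner_add_left, real_inner_smul_left] at h5
    have ht0' : (0 : ℝ) < t := ht0
    nlinarith
  have hle : ‖G‖ ≤ ⟪G, u⟫ := by
    by_contra! hlt
    have hGpos : 0 < ‖G‖ := norm_pos_iff.2 hG0
    have h6 := hdesc (‖G‖ • u - G) (by
      rw [inner_sub_right, real_inner_smul_right, real_inner_self_eq_norm_sq]
      nlinarith)
    rw [inner_sub_left, real_inner_smul_left, real_inner_self_eq_norm_sq, hu] at h6
    linarith
  have heq : ⟪G, u⟫ = ‖G‖ * ‖u‖ :=
    le_antisymm (real_inner_le_norm G u) (by simpa [hu] using hle)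
  have hGu : G = ‖G‖ • u := by
    have := inner_eq_norm_mul_iff_real.1 heq
    simpa [hu] using this
  refine ⟨‖G‖, norm_pos_iff.2 hG0, fun w => ?_⟩
  rw [hGw, ← real_inner_smul_left, ← hGu]

/-- A tangent vector at a regular point of a level set of a `C²` function is the velocity of a
`C²` curve, defined on all of `ℝ`, in that level set. -/
lemma exists_contDiff_curve_in_level {E : Type*} [NormedAddCommGroup E] [NormedSpace ℝ E]
    {f : E → ℝ} (hf : ContDiff ℝ 2 f) {x u v : E} (hv : fderiv ℝ f x v = 0)
    (hu : fderiv ℝ f x u ≠ 0) :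
    ∃ γ : ℝ → E, ContDiff ℝ 2 γ ∧ (∀ s, f (γ s) = f x) ∧ γ 0 = x ∧ deriv γ 0 = v := by
  set F : ℝ × ℝ → ℝ := fun z => f (x + z.1 • v + z.2 • u) with hF
  have hFc : ContDiff ℝ 2 F := by fun_prop
  have hFc0 : ContDiffAt ℝ 2 F ((0, 0) : ℝ × ℝ) := hFc.contDiffAt
  have hF2 : (fderiv ℝ F ((0, 0) : ℝ × ℝ) ∘L .inr ℝ ℝ ℝ) 1 = fderiv ℝ f x u := by
    have h1 : HasDerivAt (fun a : ℝ => F (0, a))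
        ((fderiv ℝ F ((0, 0) : ℝ × ℝ) ∘L .inr ℝ ℝ ℝ) 1) 0 := by
      have h := (hFc.differentiable (by norm_num) ((0, 0) : ℝ × ℝ)).hasFDerivAt
      have h' := h.comp_hasDerivAt (0 : ℝ)
        ((hasDerivAt_const (0 : ℝ) (0 : ℝ)).prodMk (hasDerivAt_id (0 : ℝ)))
      simp only [ContinuousLinearMap.comp_apply, ContinuousLinearMap.inr_apply]
      exact h'
    have h2 : HasDerivAt (fun a : ℝ => F (0, a)) (fderiv ℝ f x u) 0 := by
      have h3 : HasDerivAt (fun a : ℝ => x + (0 : ℝ) • v + a • u) u 0 := by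
        simpa using ((hasDerivAt_id (0 : ℝ)).smul_const u).const_add (x + (0 : ℝ) • v)
      have h4 : HasFDerivAt f (fderiv ℝ f x) (x + (0 : ℝ) • v + (0 : ℝ) • u) := by
        simpa using (hf.differentiable (by norm_num) x).hasFDerivAt
      exact h4.comp_hasDerivAt 0 h3
    exact h1.unique h2
  have hinv : (fderiv ℝ F ((0, 0) : ℝ × ℝ) ∘L .inr ℝ ℝ ℝ).IsInvertible := by
    refine ⟨ContinuousLinearEquiv.unitsEquivAut ℝ (Units.mk0 _ hu), ?_⟩
    ext
    simpa using hF2.symm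
  set a := hFc0.implicitFunction (by norm_num) hinv with ha
  have ha0 : a 0 = 0 := hFc0.implicitFunction_apply_self (by norm_num) hinv
  have hac : ContDiffAt ℝ 2 a 0 := hFc0.contDiffAt_implicitFunction (by norm_num) hinv
  have haF : ∀ᶠ s in 𝓝 (0 : ℝ), F (s, a s) = F (0, 0) :=
    hFc0.eventually_apply_implicitFunction (by norm_num) hinv
  obtain ⟨ε, hε, hball⟩ := Metric.eventually_nhds_iff.1 (haF.and (hac.eventually (by decide)))
  set σ : ℝ → ℝ := fun s => (ε / 2) * Real.sin (s / (ε / 2)) with hσ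
  have hσc : ContDiff ℝ 2 σ := by fun_prop
  have hσ0 : σ 0 = 0 := by simp [hσ]
  have hσd : HasDerivAt σ 1 0 := by
    have h := (((hasDerivAt_id (0 : ℝ)).div_const (ε / 2)).sin).const_mul (ε / 2)
    exact h.congr_deriv (by simp [hε.ne'])
  have hσε : ∀ s, dist (σ s) 0 < ε := by
    intro s
    rw [Real.dist_0_eq_abs, hσ, abs_mul, abs_of_pos (half_pos hε)]
    nlinarith [Real.abs_sin_le_one (s / (ε / 2))]
  have hAc : ContDiff ℝ 2 (fun s => a (σ s)) := contDiff_iff_contDiffAt.2 fun s =>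
    (hball (hσε s)).2.comp s hσc.contDiffAt
  set γ : ℝ → E := fun s => x + σ s • v + a (σ s) • u with hγ
  have hγc : ContDiff ℝ 2 γ :=
    (contDiff_const.add (hσc.smul contDiff_const)).add (hAc.smul contDiff_const)
  have hγf : ∀ s, f (γ s) = f x := fun s => by
    have := (hball (hσε s)).1
    simpa [hF] using this
  have hγ0 : γ 0 = x := by simp [hγ, hσ0, ha0]
  refine ⟨γ, hγc, hγf, hγ0, ?_⟩
  set A' := deriv (fun s => a (σ s)) 0
  have hγd : HasDerivAt γ (v + A' • u) 0 := by
    have h := ((hσd.smul_const v).const_add x).add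
      ((hAc.differentiable (by norm_num) 0).hasDerivAt.smul_const u)
    rw [one_smul] at h
    exact h
  have h4 : HasFDerivAt f (fderiv ℝ f x) (γ 0) := by
    rw [hγ0]; exact (hf.differentiable (by norm_num) x).hasFDerivAt
  have h5 := h4.comp_hasDerivAt 0 hγd
  have h6 : f ∘ γ = fun _ => f x := funext hγf
  rw [h6] at h5
  have h7 := h5.unique (hasDerivAt_const (0 : ℝ) (f x))
  rw [map_add, hv, map_smul, zero_add, smul_eq_mul] at h7
  have hA : A' = 0 := (mul_eq_zero.1 h7).resolve_right hu
  rw [hγd.deriv, hA, zero_smul, add_zero]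

/-- A continuous function that is locally supported from below by combinations of `cos` and `sin`,
vanishes at `0` and is nonnegative near `0`, is nonnegative on `[0, π]`. -/
lemma nonneg_of_local_trig_support {Q : ℝ → ℝ} (hQ : Continuous Q) (hQ0 : ∀ᶠ θ in 𝓝 0, 0 ≤ Q θ)
    (hsupp : ∀ θ₀, ∃ A B : ℝ, A * Real.cos θ₀ + B * Real.sin θ₀ = Q θ₀ ∧
      ∀ᶠ θ in 𝓝 θ₀, A * Real.cos θ + B * Real.sin θ ≤ Q θ)
    (hQz : Q 0 = 0) {θ₁ : ℝ} (hθ : θ₁ ∈ Icc 0 Real.pi) : 0 ≤ Q θ₁ := by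
  have hclosed : IsClosed {θ | 0 ≤ Q θ} := isClosed_le continuous_const hQ
  suffices h : ∀ θ₁ ∈ Ioo 0 Real.pi, 0 ≤ Q θ₁ by
    have := hclosed.closure_subset_iff.2 h
    rw [closure_Ioo Real.pi_pos.ne] at this
    exact this hθ
  clear hθ θ₁
  rintro θ₁ ⟨h0, hpi⟩
  by_contra! hneg
  set C : ℝ → ℝ := fun θ => Real.cos (θ - θ₁ / 2) with hC
  have hCpos : ∀ θ ∈ Icc 0 θ₁, 0 < C θ := fun θ hθ =>
    Real.cos_pos_of_mem_Ioo ⟨by linarith [hθ.1], by linarith [hθ.2]⟩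
  have hsin1 : 0 < Real.sin θ₁ := Real.sin_pos_of_pos_of_lt_pi h0 hpi
  set b : ℝ := - Q θ₁ / Real.sin θ₁ with hb
  have hbpos : 0 < b := div_pos (by linarith) hsin1
  set ψ : ℝ → ℝ := fun θ => Q θ + b * Real.sin θ with hψ
  have hψc : Continuous ψ := by fun_prop
  have hψ1 : ψ θ₁ = 0 := by simp only [hψ, hb]; field_simp; ring
  have hψ0 : ψ 0 = 0 := by simp [hψ, hQz]
  obtain ⟨θm, hθm, hmaxm⟩ := (isCompact_Icc (a := 0) (b := θ₁)).exists_isMaxOn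
    ⟨0, le_rfl, h0.le⟩ (f := fun θ => ψ θ / C θ)
    (hψc.continuousOn.div (by fun_prop) fun θ hθ => (hCpos θ hθ).ne')
  set M := ψ θm / C θm with hM
  have hMpos : 0 < M := by
    have hev : ∀ᶠ θ in 𝓝[>] (0 : ℝ), 0 ≤ Q θ ∧ θ < θ₁ :=
      (hQ0.and (eventually_lt_nhds h0)).filter_mono nhdsWithin_le_nhds
    obtain ⟨θ, ⟨h1, h2⟩, h3⟩ := (hev.and self_mem_nhdsWithin).exists
    have h3' : 0 < θ := h3
    have hm : θ ∈ Icc 0 θ₁ := ⟨h3'.le, h2.le⟩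
    refine lt_of_lt_of_le ?_ (hmaxm hm)
    refine div_pos ?_ (hCpos θ hm)
    have := mul_pos hbpos (Real.sin_pos_of_pos_of_lt_pi h3' (h2.trans hpi))
    simp only [hψ]; linarith
  set φ : ℝ → ℝ := fun θ => ψ θ - M * C θ with hφ
  have hφc : Continuous φ := by fun_prop
  have hφle : ∀ θ ∈ Icc 0 θ₁, φ θ ≤ 0 := by
    intro θ hθ
    have : ψ θ / C θ ≤ M := hmaxm hθ
    rw [div_le_iff₀ (hCpos θ hθ)] at this
    simp only [hφ]; linarith
  have hφm : 0 ≤ φ θm := by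
    have : ψ θm = M * C θm := by rw [hM, div_mul_cancel₀ _ (hCpos θm hθm).ne']
    simp only [hφ]; linarith
  have hφ0 : φ 0 < 0 := by
    have := mul_pos hMpos (hCpos 0 ⟨le_rfl, h0.le⟩)
    simp only [hφ, hψ0]; linarith
  have hφ1 : φ θ₁ < 0 := by
    have := mul_pos hMpos (hCpos θ₁ ⟨h0.le, le_rfl⟩)
    simp only [hφ, hψ1]; linarith
  have hsub : Icc θm θ₁ ⊆ {θ | 0 ≤ φ θ} := by
    refine IsClosed.Icc_subset_of_forall_exists_gt
      ((isClosed_le continuous_const hφc).inter isClosed_Icc) hφm ?_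
    rintro x ⟨hx, hxm⟩ y hy
    have hx0 : 0 ≤ φ x := hx
    have hxpos : 0 < x := by
      rcases (hθm.1.trans hxm.1).eq_or_lt with h | h
      · rw [← h] at hx0; linarith
      · exact h
    have hxz : φ x = 0 := le_antisymm (hφle x ⟨hxpos.le, hxm.2.le⟩) hx0
    obtain ⟨A, B, hAB, hev⟩ := hsupp x
    set A' := A - M * Real.cos (θ₁ / 2) with hA'
    set B' := B + b - M * Real.sin (θ₁ / 2) with hB'
    have hT : ∀ θ, A' * Real.cos θ + B' * Real.sin θ =
        A * Real.cos θ + B * Real.sin θ + b * Real.sin θ - M * C θ := by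
      intro θ
      simp only [hC, hA', hB', Real.cos_sub]; ring
    have hTx : A' * Real.cos x + B' * Real.sin x = 0 := by
      rw [hT, hAB]; exact hxz
    have hTle : ∀ᶠ θ in 𝓝 x, A' * Real.cos θ + B' * Real.sin θ ≤ φ θ := by
      filter_upwards [hev] with θ hθ
      rw [hT]; simp only [hφ, hψ]; linarith
    have hlm : IsLocalMax (fun θ => A' * Real.cos θ + B' * Real.sin θ) x := by
      filter_upwards [hTle, eventually_gt_nhds hxpos, eventually_lt_nhds hxm.2] with θ h1 h2 h3
      simp only [hTx]
      exact h1.trans (hφle θ ⟨h2.le, h3.le⟩)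
    have hTd : -A' * Real.sin x + B' * Real.cos x = 0 := by
      have hd : HasDerivAt (fun θ => A' * Real.cos θ + B' * Real.sin θ)
          (A' * -Real.sin x + B' * Real.cos x) x :=
        ((Real.hasDerivAt_cos x).const_mul A').add ((Real.hasDerivAt_sin x).const_mul B')
      have := hlm.hasDerivAt_eq_zero hd
      linarith
    have hA0 : A' = 0 := by
      linear_combination Real.cos x * hTx - Real.sin x * hTd - A' * Real.sin_sq_add_cos_sq x
    have hB0 : B' = 0 := by
      linear_combination Real.sin x * hTx + Real.cos x * hTd - B' * Real.sin_sq_add_cos_sq x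
    have hy' : x < y := hy
    have hev2 : ∀ᶠ θ in 𝓝[>] x, 0 ≤ φ θ ∧ θ < y := by
      refine (Eventually.and ?_ (eventually_lt_nhds hy')).filter_mono nhdsWithin_le_nhds
      filter_upwards [hTle] with θ hθ
      simpa [hA0, hB0] using hθ
    obtain ⟨θ, ⟨h1, h2⟩, h3⟩ := (hev2.and self_mem_nhdsWithin).exists
    exact ⟨θ, h1, h3, h2.le⟩
  exact absurd (hsub ⟨hθm.2, le_rfl⟩) (not_le.2 hφ1)

/-- Circular arcs of radius less than the radius of curvature stay locally in the sublevel set. -/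
lemma eventually_arc_le {E : Type*} [NormedAddCommGroup E] [InnerProductSpace ℝ E]
    {f : E → ℝ} (hf : ContDiff ℝ 2 f) {x u v : E} {g κ r : ℝ} (hg : 0 < g)
    (hgrad : ∀ w, fderiv ℝ f x w = g * ⟪u, w⟫) (hu : ‖u‖ = 1) (huv : ⟪u, v⟫ = 0)
    (hhess : fderiv ℝ (fderiv ℝ f) x v v ≤ κ * g) (hr : 0 < r) (hrκ : r * κ < 1) :
    ∀ᶠ s in 𝓝 (0 : ℝ), f (x + r • ((Real.cos s - 1) • u + Real.sin s • v)) ≤ f x := by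
  set β : ℝ → E := fun s => x + r • ((Real.cos s - 1) • u + Real.sin s • v) with hβ
  have hβc : ContDiff ℝ 2 β := by fun_prop
  have hd : ∀ s, HasDerivAt β (r • ((-Real.sin s) • u + Real.cos s • v)) s := fun s =>
    (((((Real.hasDerivAt_cos s).sub_const 1).smul_const u).add
      ((Real.hasDerivAt_sin s).smul_const v)).const_smul r).const_add x
  have hdβ : deriv β = fun s => r • ((-Real.sin s) • u + Real.cos s • v) :=
    funext fun s => (hd s).deriv
  have hd2 : deriv (deriv β) 0 = -(r • u) := by
    rw [hdβ]
    have h := ((((Real.hasDerivAt_sin 0).neg).smul_const u).add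
      ((Real.hasDerivAt_cos 0).smul_const v)).const_smul r
    exact (h.congr_deriv (by simp)).deriv
  have hβ0 : β 0 = x := by simp [hβ]
  have hd1 : deriv β 0 = r • v := by simp [hdβ]
  have hfd : Differentiable ℝ f := hf.differentiable (by norm_num)
  have hloc : IsLocalMax (fun s => f (β s)) 0 := by
    refine isLocalMax_of_deriv_deriv_neg ?_ ?_ (hf.comp hβc).continuous.continuousAt
    · rw [deriv_deriv_comp_curve hf hβc, hd2, hd1, hβ0, hgrad, inner_neg_right,
        real_inner_smul_right, real_inner_self_eq_norm_sq, hu]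
      simp only [map_smul, smul_apply, smul_eq_mul]
      have h1 := mul_le_mul_of_nonneg_left hhess (mul_pos hr hr).le
      have h2 := mul_pos (mul_pos hr hg) (sub_pos.2 hrκ)
      nlinarith
    · have h := (hfd (β 0)).hasFDerivAt.comp_hasDerivAt 0 (hd 0)
      have h' := h.deriv
      rw [← hd 0 |>.deriv, hd1, hβ0, hgrad, real_inner_smul_right, huv] at h'
      rw [mul_zero, mul_zero] at h'
      exact h'
  filter_upwards [hloc] with s hs
  rw [hβ0] at hs
  exact hs

lemma norm_smul_add_smul_eq_one {E : Type*} [NormedAddCommGroup E] [InnerProductSpace ℝ E]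
    {e v : E} (he : ‖e‖ = 1) (hv : ‖v‖ = 1) (hev : ⟪e, v⟫ = 0) {a b : ℝ}
    (hab : a ^ 2 + b ^ 2 = 1) : ‖a • e + b • v‖ = 1 := by
  have h : ‖a • e + b • v‖ ^ 2 = 1 := by
    rw [norm_add_sq_real, real_inner_smul_left, real_inner_smul_right, hev, norm_smul, norm_smul,
      he, hv, Real.norm_eq_abs, Real.norm_eq_abs, mul_one, mul_one, sq_abs, sq_abs]
    linarith
  exact (pow_eq_one_iff_of_nonneg (norm_nonneg _) two_ne_zero).1 h

lemma exists_angle_decomposition {E : Type*} [NormedAddCommGroup E] [InnerProductSpace ℝ E]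
    {e e' w : E} (he : ‖e‖ = 1) (he' : ‖e'‖ = 1) (hee' : ⟪e, e'⟫ = 0) (hw : ‖w‖ = 1) :
    ∃ v : E, ∃ θ ∈ Icc 0 Real.pi, ‖v‖ = 1 ∧ ⟪e, v⟫ = 0 ∧
      w = Real.cos θ • e + Real.sin θ • v := by
  have habs : |⟪e, w⟫| ≤ 1 := by simpa [he, hw] using abs_real_inner_le_norm e w
  set θ := Real.arccos ⟪e, w⟫ with hθ
  have hcos : Real.cos θ = ⟪e, w⟫ := Real.cos_arccos (abs_le.1 habs).1 (abs_le.1 habs).2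
  have hmem : θ ∈ Icc 0 Real.pi := ⟨Real.arccos_nonneg _, Real.arccos_le_pi _⟩
  have hsin : 0 ≤ Real.sin θ := Real.sin_nonneg_of_mem_Icc hmem
  have hn : ‖w - Real.cos θ • e‖ = Real.sin θ := by
    have h : ‖w - Real.cos θ • e‖ ^ 2 = Real.sin θ ^ 2 := by
      rw [norm_sub_sq_real, real_inner_smul_right, norm_smul, real_inner_comm, ← hcos, hw, he,
        Real.norm_eq_abs, mul_one, sq_abs, Real.sin_sq]
      ring
    exact (sq_eq_sq₀ (norm_nonneg _) hsin).1 h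
  rcases hsin.eq_or_lt with h0 | hpos
  · refine ⟨e', θ, hmem, he', hee', ?_⟩
    rw [← h0, norm_eq_zero, sub_eq_zero] at hn
    rw [← h0, zero_smul, add_zero, hn]
  · refine ⟨(Real.sin θ)⁻¹ • (w - Real.cos θ • e), θ, hmem, ?_, ?_, ?_⟩
    · rw [norm_smul, hn, norm_inv, Real.norm_of_nonneg hsin, inv_mul_cancel₀ hpos.ne']
    · rw [real_inner_smul_right, inner_sub_right, real_inner_smul_right,
        real_inner_self_eq_norm_sq, he, hcos]
      ring
    · rw [smul_inv_smul₀ hpos.ne']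
      abel

lemma closedBall_subset_of_forall_exists_inner_le {E : Type*} [NormedAddCommGroup E]
    [InnerProductSpace ℝ E] [CompleteSpace E] {K : Set E} (hconv : Convex ℝ K) (hK : IsClosed K)
    (hne : K.Nonempty) {c : E} {r : ℝ}
    (h : ∀ w : E, ‖w‖ = 1 → ∃ x ∈ K, ⟪c, w⟫ + r ≤ ⟪x, w⟫) : Metric.closedBall c r ⊆ K := by
  intro z hz
  by_contra hzK
  obtain ⟨l, a, hla, haz⟩ := geometric_hahn_banach_closed_point hconv hK hzK
  set y := (InnerProductSpace.toDual ℝ E).symm l with hy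
  have hly : ∀ w, l w = ⟪y, w⟫ := fun w => by rw [hy, InnerProductSpace.toDual_symm_apply]
  have hy0 : y ≠ 0 := by
    rintro h0
    obtain ⟨x, hx⟩ := hne
    have := (hla x hx).trans haz
    rw [hly, hly, h0] at this
    simp at this
  have hypos : 0 < ‖y‖ := norm_pos_iff.2 hy0
  have hunit : ‖(‖y‖⁻¹ • y)‖ = 1 := by
    rw [norm_smul, norm_inv, norm_norm, inv_mul_cancel₀ hypos.ne']
  obtain ⟨x, hx, hle⟩ := h _ hunit
  have hxz : ⟪x, ‖y‖⁻¹ • y⟫ < ⟪z, ‖y‖⁻¹ • y⟫ := by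
    rw [real_inner_smul_right, real_inner_smul_right, real_inner_comm, real_inner_comm y z, ← hly,
      ← hly]
    exact mul_lt_mul_of_pos_left ((hla x hx).trans haz) (inv_pos.2 hypos)
  have hzc : ⟪z - c, ‖y‖⁻¹ • y⟫ ≤ r := by
    refine (real_inner_le_norm _ _).trans ?_
    rw [hunit, mul_one, ← dist_eq_norm]
    exact hz
  rw [inner_sub_left] at hzc
  linarith

/-- A compact convex set which, at each of its support points, locally contains the circular arcs
of radius `r` touching the supporting hyperplane there contains the whole ball of radius `r`
touching it at any given support point. -/
lemma closedBall_subset_of_local_arcs {E : Type*} [NormedAddCommGroup E]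
    [InnerProductSpace ℝ E] [CompleteSpace E] {K : Set E} (hK : IsCompact K)
    (hconv : Convex ℝ K) {r : ℝ}
    (harc : ∀ x ∈ K, ∀ u v : E, ‖u‖ = 1 → ‖v‖ = 1 → ⟪u, v⟫ = 0 → (∀ y ∈ K, ⟪y, u⟫ ≤ ⟪x, u⟫) →
      ∀ᶠ s in 𝓝 (0 : ℝ), x + r • ((Real.cos s - 1) • u + Real.sin s • v) ∈ K)
    {p e e' : E} (hp : p ∈ K) (he : ‖e‖ = 1) (he' : ‖e'‖ = 1) (hee' : ⟪e, e'⟫ = 0)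
    (hsupp : ∀ y ∈ K, ⟪y, e⟫ ≤ ⟪p, e⟫) : Metric.closedBall (p - r • e) r ⊆ K := by
  have hne : K.Nonempty := ⟨p, hp⟩
  refine closedBall_subset_of_forall_exists_inner_le hconv hK.isClosed hne fun w hw => ?_
  obtain ⟨v, θ₁, hθ₁, hv, hev, rfl⟩ := exists_angle_decomposition he he' hee' hw
  set U : ℝ → E := fun θ => Real.cos θ • e + Real.sin θ • v with hU
  have hUc : Continuous U := by fun_prop
  have hUn' : ∀ θ, ‖U θ‖ = 1 := fun θ =>
    norm_smul_add_smul_eq_one he hv hev (Real.cos_sq_add_sin_sq θ)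
  have hUn : ∀ θ, ⟪U θ, U θ⟫ = 1 := fun θ => by
    rw [real_inner_self_eq_norm_sq, hUn', one_pow]
  set H : ℝ → ℝ := fun θ => sSup ((fun x => ⟪x, U θ⟫) '' K) with hH
  have hHc : Continuous H := hK.continuous_sSup (f := fun θ x => ⟪x, U θ⟫) (by fun_prop)
  have hHle : ∀ θ, ∀ x ∈ K, ⟪x, U θ⟫ ≤ H θ := fun θ x hx =>
    le_csSup (hK.image (by fun_prop)).bddAbove ⟨x, hx, rfl⟩
  have hHmax : ∀ θ, ∃ x ∈ K, H θ = ⟪x, U θ⟫ := fun θ => by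
    obtain ⟨x, hx, h⟩ := hK.exists_sSup_image_eq hne (f := fun x => ⟪x, U θ⟫) (by fun_prop)
    exact ⟨x, hx, h⟩
  have hloc : ∀ θ₀, ∀ x ∈ K, H θ₀ = ⟪x, U θ₀⟫ →
      ∀ᶠ θ in 𝓝 θ₀, ⟪x - r • U θ₀, U θ⟫ + r ≤ H θ := by
    intro θ₀ x hx hmax
    have h := harc x hx (U θ₀) (-Real.sin θ₀ • e + Real.cos θ₀ • v) (hUn' θ₀)
      (norm_smul_add_smul_eq_one he hv hev (by rw [neg_sq, Real.sin_sq_add_cos_sq])) (by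
      simp only [hU, inner_add_left, inner_add_right, real_inner_smul_left, real_inner_smul_right,
        real_inner_self_eq_norm_sq, he, hv, hev, real_inner_comm e v]
      ring) (fun y hy => hmax ▸ hHle θ₀ y hy)
    have ht : Tendsto (fun θ : ℝ => θ - θ₀) (𝓝 θ₀) (𝓝 0) :=
      (continuous_id.sub continuous_const).tendsto' _ _ (by simp)
    filter_upwards [ht.eventually h] with θ hθ
    have hrot : (Real.cos (θ - θ₀) - 1) • U θ₀ +
        Real.sin (θ - θ₀) • (-Real.sin θ₀ • e + Real.cos θ₀ • v) = U θ - U θ₀ := by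
      have h1 : Real.cos θ = Real.cos (θ - θ₀) * Real.cos θ₀ - Real.sin (θ - θ₀) * Real.sin θ₀ := by
        rw [← Real.cos_add, sub_add_cancel]
      have h2 : Real.sin θ = Real.sin (θ - θ₀) * Real.cos θ₀ + Real.cos (θ - θ₀) * Real.sin θ₀ := by
        rw [← Real.sin_add, sub_add_cancel]
      simp only [hU]
      rw [h1, h2]
      module
    rw [hrot] at hθ
    have h3 := hHle θ _ hθ
    have h4 : x + r • (U θ - U θ₀) = (x - r • U θ₀) + r • U θ := by module
    rwa [h4, inner_add_left, real_inner_smul_left, hUn, mul_one] at h3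
  have hU0 : U 0 = e := by simp [hU]
  have hH0 : H 0 = ⟪p, U 0⟫ := by
    obtain ⟨x, hx, h⟩ := hHmax 0
    refine le_antisymm ?_ (hHle 0 p hp)
    rw [h, hU0]
    exact hsupp x hx
  have hQ : 0 ≤ H θ₁ - ⟪p - r • e, U θ₁⟫ - r := by
    refine nonneg_of_local_trig_support (Q := fun θ => H θ - ⟪p - r • e, U θ⟫ - r)
      (by fun_prop) ?_ ?_ ?_ hθ₁
    · filter_upwards [hloc 0 p hp hH0] with θ hθ
      rw [hU0] at hθ
      linarith
    · intro θ₀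
      obtain ⟨x, hx, h⟩ := hHmax θ₀
      have hlin : ∀ θ, ⟪(x - r • U θ₀) - (p - r • e), e⟫ * Real.cos θ +
          ⟪(x - r • U θ₀) - (p - r • e), v⟫ * Real.sin θ =
            ⟪x - r • U θ₀, U θ⟫ - ⟪p - r • e, U θ⟫ := by
        intro θ
        rw [← inner_sub_left]
        simp only [hU, inner_add_right, real_inner_smul_right]
        ring
      refine ⟨_, _, (hlin θ₀).trans ?_, ?_⟩
      · rw [h, inner_sub_left x, real_inner_smul_left, hUn]
        ring
      · filter_upwards [hloc θ₀ x hx h] with θ hθ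
        rw [hlin]
        linarith
    · simp only [hH0, hU0, inner_sub_left, real_inner_smul_left, real_inner_self_eq_norm_sq, he]
      ring
  obtain ⟨x, hx, h⟩ := hHmax θ₁
  exact ⟨x, hx, by rw [← h]; linarith⟩

end RollingBall

open Filter Topology Set in
/-- Blaschke's Rolling Ball Theorem, plus the distance consequence:
Let `K ⊂ ℝ^m` be a convex body with `C²` boundary and nowhere vanishing Gaussian
curvature, let `κ` be the maximum of the principal curvatures over `∂K`, attained
at `p ∈ ∂K` with inward unit normal `ν`, and let `c = p + κ⁻¹ • ν` be the
corresponding centre of curvature. Then the closed ball of radius `κ⁻¹` centred at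
`c` is contained in `K`, and the distance function `x ↦ |x − c|` on `∂K` attains
its global minimum at `p`. -/
theorem blaschke_rolling_ball {m : ℕ} (hm : 1 ≤ m)
    (K : Set (EuclideanSpace ℝ (Fin m)))
    (hK : IsCompact K) (hconv : Convex ℝ K) (hint : (interior K).Nonempty)
    -- `C²` boundary: `K` is a regular sublevel set of a `C²` function
    (f : EuclideanSpace ℝ (Fin m) → ℝ) (hf : ContDiff ℝ 2 f)
    (hlev : K = {x | f x ≤ 1}) (hfront : frontier K = {x | f x = 1})
    (hreg : ∀ x ∈ frontier K, fderiv ℝ f x ≠ 0)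
    -- nowhere vanishing Gaussian curvature: the second fundamental form (the
    -- tangential Hessian of the defining function) is positive definite on `∂K`
    (hgauss : ∀ x ∈ frontier K, ∀ v : EuclideanSpace ℝ (Fin m), v ≠ 0 →
      fderiv ℝ f x v = 0 → 0 < iteratedFDeriv ℝ 2 f x ![v, v])
    -- `p ∈ ∂K` with inward unit normal `ν`
    (p : EuclideanSpace ℝ (Fin m)) (hp : p ∈ frontier K)
    (ν : EuclideanSpace ℝ (Fin m)) (hν : ‖ν‖ = 1)
    (hsupp : ∀ x ∈ K, 0 ≤ ⟪x - p, ν⟫)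
    -- `κ > 0` is a principal (normal) curvature at `p` and is the maximum of all
    -- normal (hence of all principal) curvatures over `∂K`
    (κ : ℝ) (hκ : 0 < κ) (hκp : IsNormalCurvatureAt K p ν κ)
    (hmax : ∀ q ∈ frontier K, ∀ ν' : EuclideanSpace ℝ (Fin m), ‖ν'‖ = 1 →
      (∀ x ∈ K, 0 ≤ ⟪x - q, ν'⟫) → ∀ κ' : ℝ, IsNormalCurvatureAt K q ν' κ' → κ' ≤ κ) :
    Metric.closedBall (p + κ⁻¹ • ν) κ⁻¹ ⊆ K ∧
      ∀ x ∈ frontier K, dist p (p + κ⁻¹ • ν) ≤ dist x (p + κ⁻¹ • ν) := by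
  have hcurv : ∀ x ∈ K, ∀ u v : EuclideanSpace ℝ (Fin m), ‖u‖ = 1 → ‖v‖ = 1 → ⟪u, v⟫ = 0 →
      (∀ y ∈ K, ⟪y, u⟫ ≤ ⟪x, u⟫) → ∃ g : ℝ, 0 < g ∧ (∀ w, fderiv ℝ f x w = g * ⟪u, w⟫) ∧
        f x = 1 ∧ fderiv ℝ (fderiv ℝ f) x v v ≤ κ * g := by
    intro x hx u v hu hv huv hxu
    have hxfr : x ∈ frontier K := by
      refine ⟨subset_closure hx, fun hxi => ?_⟩
      have ht : Tendsto (fun t : ℝ => x + t • u) (𝓝[>] 0) (𝓝 x) :=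
        ((by fun_prop : Continuous fun t : ℝ => x + t • u).tendsto' 0 x (by simp)).mono_left
          nhdsWithin_le_nhds
      obtain ⟨t, ht1, ht0⟩ :=
        ((ht.eventually (mem_interior_iff_mem_nhds.1 hxi)).and self_mem_nhdsWithin).exists
      have h1 := hxu _ ht1
      have ht0' : 0 < t := ht0
      rw [inner_add_left, real_inner_smul_left, real_inner_self_eq_norm_sq, hu] at h1
      linarith
    have hfx : f x = 1 := by rw [hfront] at hxfr; exact hxfr
    obtain ⟨g, hg, hgrad⟩ := exists_fderiv_eq_mul_inner
      (hf.differentiable (by norm_num) x) (hreg x hxfr) hu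
      (fun y hy => hxu y (by rw [hlev]; exact hy.trans hfx.le))
    refine ⟨g, hg, hgrad, hfx, ?_⟩
    obtain ⟨γ, hγc, hγf, hγ0, hγd⟩ := exists_contDiff_curve_in_level hf (x := x) (u := u) (v := v)
      (by rw [hgrad, huv, mul_zero])
      (by rw [hgrad, real_inner_self_eq_norm_sq, hu]; simpa using hg.ne')
    have hle := hmax x hxfr (-u) (by rwa [norm_neg])
      (fun y hy => by
        rw [inner_neg_right, inner_sub_left]
        linarith [hxu y hy]) _
      ⟨γ, hγc, fun s => by rw [hfront]; exact (hγf s).trans hfx, hγ0, by rw [hγd, hv], rfl⟩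
    have h2 := deriv_deriv_comp_curve hf hγc 0
    rw [funext hγf, hγ0, hγd, hgrad] at h2
    simp only [deriv_const', deriv_const] at h2
    rw [inner_neg_right, real_inner_comm] at hle
    nlinarith
  have hpK : p ∈ K := hK.isClosed.frontier_subset hp
  obtain ⟨γ, hγc, hγK, hγ0, hγ1, -⟩ := hκp
  have hνγ : ⟪-ν, deriv γ 0⟫ = 0 := by
    have hmin : IsLocalMin (fun s => ⟪ν, γ s - p⟫) 0 := Eventually.of_forall fun s => by
      simp only [hγ0, sub_self, inner_zero_right]
      rw [real_inner_comm]
      exact hsupp _ (hK.isClosed.frontier_subset (hγK s))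
    have hd : HasDerivAt (fun s => ⟪ν, γ s - p⟫) ⟪ν, deriv γ 0⟫ 0 := by
      have h := (hasDerivAt_const (0 : ℝ) ν).inner ℝ
        ((hγc.differentiable (by norm_num) 0).hasDerivAt.sub_const p)
      simpa using h
    rw [inner_neg_left, hmin.hasDerivAt_eq_zero hd, neg_zero]
  have hsmall : ∀ r : ℝ, 0 < r → r * κ < 1 → Metric.closedBall (p + r • ν) r ⊆ K := by
    intro r hr hrκ
    have h := closedBall_subset_of_local_arcs (r := r) hK hconv
      (fun x hx u v hu hv huv hxu => by
        obtain ⟨g, hg, hgrad, hfx, hhess⟩ := hcurv x hx u v hu hv huv hxu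
        filter_upwards [eventually_arc_le hf hg hgrad hu huv hhess hr hrκ] with s hs
        rw [hlev]
        exact hs.trans hfx.le)
      hpK (by rwa [norm_neg]) hγ1 hνγ
      (fun y hy => by
        have := hsupp y hy
        rw [inner_sub_left] at this
        rw [inner_neg_right, inner_neg_right]
        linarith)
    rwa [smul_neg, sub_neg_eq_add] at h
  have hball : Metric.closedBall (p + κ⁻¹ • ν) κ⁻¹ ⊆ K := by
    intro z hz
    have ht : Tendsto (fun t : ℝ => p + t • (z - p)) (𝓝[<] 1) (𝓝 z) :=
      ((by fun_prop : Continuous fun t : ℝ => p + t • (z - p)).tendsto' 1 z (by simp)).mono_left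
        nhdsWithin_le_nhds
    refine hK.isClosed.mem_of_tendsto ht ?_
    filter_upwards [Ioo_mem_nhdsLT (zero_lt_one' ℝ)] with t ht
    refine hsmall (t * κ⁻¹) (mul_pos ht.1 (inv_pos.2 hκ))
      (by rw [inv_mul_cancel_right₀ hκ.ne']; exact ht.2) ?_
    rw [Metric.mem_closedBall, dist_eq_norm] at hz ⊢
    have h1 : p + t • (z - p) - (p + (t * κ⁻¹) • ν) = t • (z - (p + κ⁻¹ • ν)) := by module
    rw [h1, norm_smul, Real.norm_of_nonneg ht.1.le]
    exact mul_le_mul_of_nonneg_left hz ht.1.le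
  refine ⟨hball, fun x hx => ?_⟩
  have hpc : dist p (p + κ⁻¹ • ν) = κ⁻¹ := by
    rw [dist_self_add_right, norm_smul, hν, mul_one, Real.norm_of_nonneg (inv_pos.2 hκ).le]
  rw [hpc]
  by_contra! hlt
  exact hx.2 (interior_mono hball (Metric.ball_subset_interior_closedBall hlt))
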